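/- Yang–Baxter equation for R_col: for all labels a_1,a_2,a_3,b_1,b_2,b_3 ∈ {0,1,…,n} and parameters x,y, one has Σ_{c_1,c_2,c_3∈{0,…,n}} R_col(x⊖y; a_1,a_2,c_1,c_2)·L(x; c_1,c_3,b_1,b_2)·L(y; c_2,a_3,c_3,b_3) = Σ_{d_1,d_2,d_3∈{0,…,n}} L(y; a_1,d_3,b_1,d_1)·L(x; a_2,a_3,d_3,d_2)·R_col(x⊖y; d_1,d_2,b_2,b_3), as identities of rational functions in x, y and β. -/

import Mathlib

open MvPolynomial

noncomputable section

namespace BPDPuzzle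

/-- `x ⊖ y = (x - y)/(1 + β·y)`. -/
def ominus {K : Type*} [Field K] (β a b : K) : K := (a - b) / (1 + β * b)

/-- A permutation of `ℕ` lying in `S_∞`, i.e. fixing all sufficiently large integers. -/
def FinPerm (w : Equiv.Perm ℕ) : Prop := ∃ N : ℕ, ∀ j, N ≤ j → w j = j

/-- A permutation of `ℕ` lying in `S_n` (0-based positions `0, …, n-1`). -/
def InSn (n : ℕ) (w : Equiv.Perm ℕ) : Prop := ∀ j, n ≤ j → w j = j

/-- Coxeter length: the number of inversions. -/
def len (w : Equiv.Perm ℕ) : ℕ := Set.ncard {p : ℕ × ℕ | p.1 < p.2 ∧ w p.2 < w p.1}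

/-- The simple transposition `s_i`, exchanging the (0-based) positions `i` and `i+1`. -/
def sTr (i : ℕ) : Equiv.Perm ℕ := Equiv.swap i (i + 1)

/-- `u` and `v` have separated descents at position `k`, i.e.
`maxdes(u) ≤ k ≤ mindes(v)` (in 0-based conventions: `u` has no descent at any
0-based position `≥ k` and `v` has no descent at any 0-based position `< k-1`). -/
def SepDesc (k : ℕ) (u v : Equiv.Perm ℕ) : Prop :=
  (∀ i, k ≤ i → u i ≤ u (i + 1)) ∧ (∀ i, i + 1 < k → v i ≤ v (i + 1))

/-- The longest element `n ⋯ 2 1` of `S_n`, extended by the identity. -/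
def revPerm (n : ℕ) : Equiv.Perm ℕ where
  toFun j := if j < n then n - 1 - j else j
  invFun j := if j < n then n - 1 - j else j
  left_inv j := by dsimp only; split_ifs <;> omega
  right_inv j := by dsimp only; split_ifs <;> omega

/-- Exchange the values of a valuation at the indices `i` and `i+1`. -/
def swapVal {K : Type*} (t : ℕ → K) (i : ℕ) : ℕ → K :=
  fun j => if j = i then t (i + 1) else if j = i + 1 then t i else t j

/-- The defining properties of the family of double Grothendieck polynomials
`𝔊_w(x, t)`, viewed as a family of polynomials in the `x`-variables depending on
a valuation `t` of the second set of variables:  the initial condition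
`𝔊_{n⋯21}(x,t) = ∏_{i+j≤n} (x_i ⊖ t_j)` together with the Demazure recursion
`π_i 𝔊_w = 𝔊_{w s_i}` whenever `w(i) > w(i+1)` (the latter written with the
denominator `x_i - x_{i+1}` cleared). -/
def GrothFamily {K : Type*} [Field K] (β : K)
    (G : (ℕ → K) → Equiv.Perm ℕ → MvPolynomial ℕ K) : Prop :=
  ∀ t : ℕ → K, (∀ j, 1 + β * t j ≠ 0) →
    (∀ n : ℕ, G t (revPerm n) =
      ∏ i ∈ Finset.range n, ∏ j ∈ Finset.range (n - 1 - i),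
        C ((1 + β * t j)⁻¹) * (X i - C (t j))) ∧
    (∀ (w : Equiv.Perm ℕ) (i : ℕ), w (i + 1) < w i →
      (X i - X (i + 1)) * G t (w * sTr i) =
        (1 + C β * X (i + 1)) * G t w
          - (1 + C β * X i) * rename ⇑(Equiv.swap i (i + 1)) (G t w))

/-- The defining property of the structure constants `c_{u,v}^w(t,y)`:
`𝔊_u(x,y) · 𝔊_v(x,t) = Σ_w c_{u,v}^w(t,y) · 𝔊_w(x,t)`, the (finitely supported)
sum ranging over the permutations `w ∈ S_∞`. -/
def StructConsts {K : Type*} [Field K] (β : K)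
    (G : (ℕ → K) → Equiv.Perm ℕ → MvPolynomial ℕ K)
    (c : (ℕ → K) → (ℕ → K) → Equiv.Perm ℕ → Equiv.Perm ℕ → Equiv.Perm ℕ → K) : Prop :=
  ∀ t y : ℕ → K, (∀ j, 1 + β * t j ≠ 0) → (∀ j, 1 + β * y j ≠ 0) →
    ∀ u v : Equiv.Perm ℕ, FinPerm u → FinPerm v →
      {w : Equiv.Perm ℕ | c t y u v w ≠ 0}.Finite ∧
      (∀ w, ¬ FinPerm w → c t y u v w = 0) ∧
      G y u * G t v = ∑ᶠ w : Equiv.Perm ℕ, C (c t y u v w) * G t w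

/-! ### The lattice model / pipe puzzles -/

/-- A state of the `n × n` lattice model: labels in `{0, …, n}` on all horizontal
and vertical (half-)edges.  `sst.1 i j` is the `j`-th horizontal (half-)edge of row
`i` (`j = 0` being the left boundary and `j = n` the right boundary), and
`sst.2 i j` is the `i`-th vertical (half-)edge of column `j` (`i = 0` the top
boundary, `i = n` the bottom boundary). -/
abbrev GridState (n : ℕ) : Type :=
  (Fin n → Fin (n + 1) → Fin (n + 1)) × (Fin (n + 1) → Fin n → Fin (n + 1))

/-- The label on the north edge of the tile in row `i`, column `j`. -/
def labN {n : ℕ} (sst : GridState n) (i j : Fin n) : ℕ := (sst.2 i.castSucc j : ℕ)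
/-- The label on the east edge of the tile in row `i`, column `j`. -/
def labE {n : ℕ} (sst : GridState n) (i j : Fin n) : ℕ := (sst.1 i j.succ : ℕ)
/-- The label on the west edge of the tile in row `i`, column `j`. -/
def labW {n : ℕ} (sst : GridState n) (i j : Fin n) : ℕ := (sst.1 i j.castSucc : ℕ)
/-- The label on the south edge of the tile in row `i`, column `j`. -/
def labS {n : ℕ} (sst : GridState n) (i j : Fin n) : ℕ := (sst.2 i.succ j : ℕ)

/-- Boundary label `κ_u` on the right side (0-based row `i`, 1-based pipe labels). -/
def kappaLab (k : ℕ) (u : Equiv.Perm ℕ) (i : ℕ) : ℕ :=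
  if u⁻¹ i < k then u⁻¹ i + 1 else 0

/-- Boundary label `θ_v` on the top side (0-based column `j`, 1-based pipe labels). -/
def thetaLab (k : ℕ) (v : Equiv.Perm ℕ) (j : ℕ) : ℕ :=
  if k ≤ v⁻¹ j then v⁻¹ j + 1 else 0

/-- Boundary label `η_w` on the bottom side (0-based column `j`, 1-based pipe labels). -/
def etaLab (w : Equiv.Perm ℕ) (j : ℕ) : ℕ := w⁻¹ j + 1

/-- The boundary condition for pipe puzzles for `(u, v, w)`: left edges all `0`,
right edges `κ_u`, top edges `θ_v`, bottom edges `η_w`. -/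
def BoundaryCond (n k : ℕ) (u v w : Equiv.Perm ℕ) (sst : GridState n) : Prop :=
  (∀ i : Fin n, (sst.1 i 0 : ℕ) = 0) ∧
  (∀ i : Fin n, (sst.1 i (Fin.last n) : ℕ) = kappaLab k u (i : ℕ)) ∧
  (∀ j : Fin n, (sst.2 0 j : ℕ) = thetaLab k v (j : ℕ)) ∧
  (∀ j : Fin n, (sst.2 (Fin.last n) j : ℕ) = etaLab w (j : ℕ))

/-- The admissible local configurations (tiles) of a pipe puzzle, in terms of the
four edge labels `N, E, W, S` around a tile:  the empty tile, the vertical pipe,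
the horizontal pipe, the crossing (with the horizontal pipe carrying the smaller
label), the two elbows `⌟` and `⌐` (labels `≤ k` coming from the right side,
labels `> k` from the top side), and the bumping tiles (with the stated label
restrictions). -/
def LAdm (k N E W S : ℕ) : Prop :=
  (N = 0 ∧ E = 0 ∧ W = 0 ∧ S = 0) ∨
  (E = 0 ∧ W = 0 ∧ 0 < N ∧ N = S) ∨
  (N = 0 ∧ S = 0 ∧ 0 < E ∧ E = W) ∨
  (0 < E ∧ E = W ∧ E < N ∧ N = S) ∨
  (E = 0 ∧ S = 0 ∧ 0 < N ∧ N = W ∧ N ≤ k) ∨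
  (E = 0 ∧ S = 0 ∧ N = W ∧ k < N) ∨
  (N = 0 ∧ W = 0 ∧ 0 < E ∧ E = S ∧ E ≤ k) ∨
  (N = 0 ∧ W = 0 ∧ E = S ∧ k < E) ∨
  (0 < E ∧ E = S ∧ E < N ∧ N = W ∧ N ≤ k) ∨
  (k < E ∧ E = S ∧ E < N ∧ N = W) ∨
  (0 < N ∧ N = W ∧ N ≤ k ∧ E = S ∧ k < E)

/-- The admissible local configurations of a Schubert pipe puzzle (no bumping
tiles; crossings have the horizontal pipe carrying the smaller label). -/
def LAdm0 (N E W S : ℕ) : Prop :=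
  (N = 0 ∧ E = 0 ∧ W = 0 ∧ S = 0) ∨
  (E = 0 ∧ W = 0 ∧ 0 < N ∧ N = S) ∨
  (N = 0 ∧ S = 0 ∧ 0 < E ∧ E = W) ∨
  (0 < E ∧ E = W ∧ E < N ∧ N = S) ∨
  (E = 0 ∧ S = 0 ∧ 0 < N ∧ N = W) ∨
  (N = 0 ∧ W = 0 ∧ 0 < E ∧ E = S)

/-- The vertex weight `L(x; N, E, W, S)` of the lattice model (equivalently, the
weight of the corresponding pipe-puzzle tile), with spectral parameter `x`. -/
def Lwt {K : Type*} [Field K] (β : K) (k : ℕ) (x : K) (N E W S : ℕ) : K :=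
  if N = 0 ∧ E = 0 ∧ W = 0 ∧ S = 0 then x
  else if E = 0 ∧ W = 0 ∧ 0 < N ∧ N = S then 1
  else if N = 0 ∧ S = 0 ∧ 0 < E ∧ E = W then 1
  else if 0 < E ∧ E = W ∧ E < N ∧ N = S then 1
  else if E = 0 ∧ S = 0 ∧ 0 < N ∧ N = W ∧ N ≤ k then 1 + β * x
  else if E = 0 ∧ S = 0 ∧ N = W ∧ k < N then 1
  else if N = 0 ∧ W = 0 ∧ 0 < E ∧ E = S ∧ E ≤ k then 1
  else if N = 0 ∧ W = 0 ∧ E = S ∧ k < E then 1 + β * x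
  else if 0 < E ∧ E = S ∧ E < N ∧ N = W ∧ N ≤ k then β
  else if k < E ∧ E = S ∧ E < N ∧ N = W then β
  else if 0 < N ∧ N = W ∧ N ≤ k ∧ E = S ∧ k < E then β * (1 + β * x)
  else 0

/-- The set of pipe puzzles for `(u, v, w)` (with separated-descent parameter `k`),
encoded as admissible states of the lattice model. -/
def PP (n k : ℕ) (u v w : Equiv.Perm ℕ) : Set (GridState n) :=
  {sst | BoundaryCond n k u v w sst ∧
    ∀ i j : Fin n, LAdm k (labN sst i j) (labE sst i j) (labW sst i j) (labS sst i j)}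

/-- The set of Schubert pipe puzzles for `(u, v, w)`. -/
def PP0 (n k : ℕ) (u v w : Equiv.Perm ℕ) : Set (GridState n) :=
  {sst | BoundaryCond n k u v w sst ∧
    ∀ i j : Fin n, LAdm0 (labN sst i j) (labE sst i j) (labW sst i j) (labS sst i j)}

/-- The weight `wt(π)` of a pipe puzzle: the product over all tiles, the tile in
row `i` and column `j` having spectral parameter `t_j ⊖ y_i`. -/
def stateWt {K : Type*} [Field K] (β : K) (k : ℕ) (t y : ℕ → K) {n : ℕ}
    (sst : GridState n) : K :=
  ∏ i : Fin n, ∏ j : Fin n,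
    Lwt β k (ominus β (t (j : ℕ)) (y (i : ℕ)))
      (labN sst i j) (labE sst i j) (labW sst i j) (labS sst i j)

/-- The Schubert weight `wt₀(π)`: the product of `t_j - y_i` over the positions
`(i, j)` of the empty tiles. -/
def stateWt0 {K : Type*} [Field K] (t y : ℕ → K) {n : ℕ} (sst : GridState n) : K :=
  ∏ i : Fin n, ∏ j : Fin n,
    if labN sst i j = 0 ∧ labE sst i j = 0 ∧ labW sst i j = 0 ∧ labS sst i j = 0
    then t (j : ℕ) - y (i : ℕ) else 1

/-- The `R`-matrix weight `R_col(x; NW, NE, SW, SE)`. -/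
def Rcol {K : Type*} [Field K] (β : K) (k : ℕ) (x : K) (NW NE SW SE : ℕ) : K :=
  if NW = NE ∧ NE = SW ∧ SW = SE then 1
  else if NE = 0 ∧ SE = 0 ∧ 0 < NW ∧ NW = SW ∧ SW ≤ k then 1
  else if NW = 0 ∧ SW = 0 ∧ k < NE ∧ NE = SE then 1
  else if 0 < NW ∧ NW = SW ∧ NW < NE ∧ NE = SE then 1
  else if NE = 0 ∧ SW = 0 ∧ 0 < NW ∧ NW = SE then x
  else if 0 < NE ∧ NE = SW ∧ NE < NW ∧ NW = SE then x
  else if NW = 0 ∧ SW = 0 ∧ 0 < NE ∧ NE = SE ∧ SE ≤ k then 1 + β * x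
  else if NE = 0 ∧ SE = 0 ∧ k < NW ∧ NW = SW then 1 + β * x
  else if 0 < NE ∧ NE = SE ∧ NE < NW ∧ NW = SW then 1 + β * x
  else 0

/-- The coefficient of the crossing `N = S`, `E = W` in the vertex weight. -/
def crossWt {K : Type*} [Field K] (x : K) (N E : ℕ) : K :=
  if N = 0 ∧ E = 0 then x else if N = 0 ∨ E < N then 1 else 0

/-- The coefficient of the turn `N = W`, `E = S` with `N ≠ E` in the vertex weight. -/
def turnWt {K : Type*} [Field K] (β : K) (k : ℕ) (x : K) (N E : ℕ) : K :=
  if N = E then 0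
  else if E = 0 then (if N ≤ k then 1 + β * x else 1)
  else if N = 0 then (if E ≤ k then 1 else 1 + β * x)
  else if E < N then (if N ≤ k ∨ k < E then β else 0)
  else if N ≤ k ∧ k < E then β * (1 + β * x) else 0

/-- The coefficient of `NW = SW`, `NE = SE` in the `R`-matrix weight. -/
def straightWt {K : Type*} [Field K] (β : K) (k : ℕ) (z : K) (a b : ℕ) : K :=
  if a = b then 1
  else if b = 0 then (if a ≤ k then 1 else 1 + β * z)
  else if a = 0 then (if b ≤ k then 1 + β * z else 1)
  else if a < b then 1 else 1 + β * z

/-- The coefficient of `NW = SE`, `NE = SW` with `NW ≠ NE` in the `R`-matrix weight. -/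
def swapWt {K : Type*} [Field K] (z : K) (a b : ℕ) : K := if b < a then z else 0

/-- The Kronecker delta of two labels. -/
def labelDelta (K : Type*) [Field K] (a b : ℕ) : K := if a = b then 1 else 0

theorem sum_labelDelta_mul {K : Type*} [Field K] {n a : ℕ} (ha : a ≤ n) (f : ℕ → K) :
    ∑ c ∈ Finset.range (n + 1), labelDelta K c a * f c = f a := by
  simp [labelDelta, Nat.lt_succ_iff.2 ha]

theorem Lwt_eq {K : Type*} [Field K] (β : K) (k : ℕ) (x : K) (N E W S : ℕ) :
    Lwt β k x N E W S =
      turnWt β k x N E * (labelDelta K W N * labelDelta K S E) +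
        crossWt x N E * (labelDelta K W E * labelDelta K S N) := by
  unfold Lwt turnWt crossWt labelDelta
  grind (splits := 40)

theorem Rcol_eq {K : Type*} [Field K] (β : K) (k : ℕ) (z : K) (a b c d : ℕ) :
    Rcol β k z a b c d =
      straightWt β k z a b * (labelDelta K c a * labelDelta K d b) +
        swapWt z a b * (labelDelta K c b * labelDelta K d a) := by
  unfold Rcol straightWt swapWt labelDelta
  grind (splits := 40)

theorem sum_sum_labelDelta_mul {K : Type*} [Field K] {n a b : ℕ} (ha : a ≤ n) (hb : b ≤ n)
    (p q : K) (f : ℕ → ℕ → K) :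
    ∑ c ∈ Finset.range (n + 1), ∑ d ∈ Finset.range (n + 1),
        (p * (labelDelta K c a * labelDelta K d b) +
          q * (labelDelta K c b * labelDelta K d a)) * f c d =
      p * f a b + q * f b a := by
  simp only [add_mul, Finset.sum_add_distrib, mul_assoc, ← Finset.mul_sum,
    sum_labelDelta_mul, ha, hb]

theorem sum_Rcol_mul {K : Type*} [Field K] (β : K) {n : ℕ} (k : ℕ) (z : K) {a b : ℕ}
    (ha : a ≤ n) (hb : b ≤ n) (f : ℕ → ℕ → K) :
    ∑ c ∈ Finset.range (n + 1), ∑ d ∈ Finset.range (n + 1), Rcol β k z a b c d * f c d =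
      straightWt β k z a b * f a b + swapWt z a b * f b a := by
  simp only [Rcol_eq, sum_sum_labelDelta_mul ha hb]

theorem sum_Lwt_mul {K : Type*} [Field K] (β : K) {n : ℕ} (k : ℕ) (x : K) {N E : ℕ}
    (hN : N ≤ n) (hE : E ≤ n) (f : ℕ → ℕ → K) :
    ∑ W ∈ Finset.range (n + 1), ∑ S ∈ Finset.range (n + 1), Lwt β k x N E W S * f W S =
      turnWt β k x N E * f N E + crossWt x N E * f E N := by
  simp only [Lwt_eq, sum_sum_labelDelta_mul hN hE]

theorem sum_Lwt_mul_west {K : Type*} [Field K] (β : K) {n : ℕ} (k : ℕ) (x : K) {N E : ℕ} (S : ℕ)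
    (hN : N ≤ n) (hE : E ≤ n) (f : ℕ → K) :
    ∑ W ∈ Finset.range (n + 1), Lwt β k x N E W S * f W =
      turnWt β k x N E * (labelDelta K S E * f N) +
        crossWt x N E * (labelDelta K S N * f E) := by
  simp only [Lwt_eq, add_mul, Finset.sum_add_distrib, mul_assoc, mul_left_comm _ (labelDelta K S _),
    ← Finset.mul_sum, sum_labelDelta_mul, hN, hE]

theorem sum_Lwt_mul_south {K : Type*} [Field K] (β : K) {n : ℕ} (k : ℕ) (x : K) {N E : ℕ} (W : ℕ)
    (hN : N ≤ n) (hE : E ≤ n) (f : ℕ → K) :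
    ∑ S ∈ Finset.range (n + 1), Lwt β k x N E W S * f S =
      turnWt β k x N E * (labelDelta K W N * f E) +
        crossWt x N E * (labelDelta K W E * f N) := by
  simp only [Lwt_eq, add_mul, Finset.sum_add_distrib, mul_assoc,
    ← Finset.mul_sum, sum_labelDelta_mul, hN, hE]

set_option maxHeartbeats 4000000 in
/-- The Yang–Baxter equation with the outgoing labels replaced by an arbitrary test function. -/
theorem yang_baxter_col_test {K : Type*} [Field K] (β : K) (k : ℕ) (x y z : K)
    (hz : z * (1 + β * y) = x - y) (a1 a2 a3 : ℕ) (D : ℕ → ℕ → ℕ → K) :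
    straightWt β k z a1 a2 *
          (turnWt β k y a2 a3 * (turnWt β k x a1 a2 * D a1 a2 a3 + crossWt x a1 a2 * D a2 a1 a3) +
            crossWt y a2 a3 * (turnWt β k x a1 a3 * D a1 a3 a2 + crossWt x a1 a3 * D a3 a1 a2)) +
        swapWt z a1 a2 *
          (turnWt β k y a1 a3 * (turnWt β k x a2 a1 * D a2 a1 a3 + crossWt x a2 a1 * D a1 a2 a3) +
            crossWt y a1 a3 * (turnWt β k x a2 a3 * D a2 a3 a1 + crossWt x a2 a3 * D a3 a2 a1)) =
      turnWt β k x a2 a3 *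
          (turnWt β k y a1 a2 *
              (straightWt β k z a2 a3 * D a1 a2 a3 + swapWt z a2 a3 * D a1 a3 a2) +
            crossWt y a1 a2 *
              (straightWt β k z a1 a3 * D a2 a1 a3 + swapWt z a1 a3 * D a2 a3 a1)) +
        crossWt x a2 a3 *
          (turnWt β k y a1 a3 *
              (straightWt β k z a3 a2 * D a1 a3 a2 + swapWt z a3 a2 * D a1 a2 a3) +
            crossWt y a1 a3 *
              (straightWt β k z a1 a2 * D a3 a1 a2 + swapWt z a1 a2 * D a3 a2 a1)) := by
  obtain rfl : x = y + z * (1 + β * y) := by rw [hz]; ring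
  clear hz
  have hclass (a : ℕ) : a = 0 ∨ (0 < a ∧ a ≤ k) ∨ k < a := by omega
  unfold straightWt turnWt crossWt swapWt
  rcases lt_trichotomy a1 a2 with h12 | h12 | h12 <;>
    rcases lt_trichotomy a1 a3 with h13 | h13 | h13 <;>
    rcases lt_trichotomy a2 a3 with h23 | h23 | h23 <;> try omega
  all_goals
    rcases hclass a1 with h1 | h1 | h1 <;> rcases hclass a2 with h2 | h2 | h2 <;>
      rcases hclass a3 with h3 | h3 | h3 <;> try omega
  all_goals
    simp (disch := omega) only [if_pos, if_neg]
    subst_vars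
    ring

/-- Theorem `thm:YBE-2` of the paper: the Yang–Baxter equation
for the `R`-matrix `R_col`. -/
theorem yang_baxter_col
    {K : Type*} [Field K] (β : K) (n k : ℕ) (hk : k ≤ n)
    (x y : K) (hden : 1 + β * y ≠ 0)
    (a1 a2 a3 b1 b2 b3 : ℕ)
    (ha1 : a1 ≤ n) (ha2 : a2 ≤ n) (ha3 : a3 ≤ n)
    (hb1 : b1 ≤ n) (hb2 : b2 ≤ n) (hb3 : b3 ≤ n) :
    (∑ c1 ∈ Finset.range (n + 1), ∑ c2 ∈ Finset.range (n + 1),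
      ∑ c3 ∈ Finset.range (n + 1),
        Rcol β k (ominus β x y) a1 a2 c1 c2 * Lwt β k x c1 c3 b1 b2 *
          Lwt β k y c2 a3 c3 b3) =
    ∑ d1 ∈ Finset.range (n + 1), ∑ d2 ∈ Finset.range (n + 1),
      ∑ d3 ∈ Finset.range (n + 1),
        Lwt β k y a1 d3 b1 d1 * Lwt β k x a2 a3 d3 d2 *
          Rcol β k (ominus β x y) d1 d2 b2 b3 := by
  have hz : ominus β x y * (1 + β * y) = x - y := div_mul_cancel₀ _ hden
  generalize ominus β x y = z at hz ⊢
  have hL (c1 c2 : ℕ) (hc2 : c2 ≤ n) :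
      ∑ c3 ∈ Finset.range (n + 1), Lwt β k x c1 c3 b1 b2 * Lwt β k y c2 a3 c3 b3 =
        turnWt β k y c2 a3 * (labelDelta K b3 a3 * Lwt β k x c1 c2 b1 b2) +
          crossWt y c2 a3 * (labelDelta K b3 c2 * Lwt β k x c1 a3 b1 b2) := by
    rw [← sum_Lwt_mul_west β k y b3 hc2 ha3 fun c3 => Lwt β k x c1 c3 b1 b2]
    simp only [mul_comm]
  have hR (d1 : ℕ) :
      ∑ d2 ∈ Finset.range (n + 1), ∑ d3 ∈ Finset.range (n + 1),
        Lwt β k y a1 d3 b1 d1 * Lwt β k x a2 a3 d3 d2 * Rcol β k z d1 d2 b2 b3 =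
        turnWt β k x a2 a3 * (Lwt β k y a1 a2 b1 d1 * Rcol β k z d1 a3 b2 b3) +
          crossWt x a2 a3 * (Lwt β k y a1 a3 b1 d1 * Rcol β k z d1 a2 b2 b3) := by
    rw [Finset.sum_comm, ← sum_Lwt_mul β k x ha2 ha3
      fun d3 d2 => Lwt β k y a1 d3 b1 d1 * Rcol β k z d1 d2 b2 b3]
    simp only [mul_assoc, mul_left_comm]
  simp only [hR]
  simp only [Finset.sum_add_distrib, mul_assoc, ← Finset.mul_sum,
    sum_Rcol_mul β k z ha1 ha2, hL _ _ ha1, hL _ _ ha2,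
    sum_Lwt_mul_south β k y b1 ha1 ha2, sum_Lwt_mul_south β k y b1 ha1 ha3]
  have key := yang_baxter_col_test β k x y z hz a1 a2 a3
    fun u v w => labelDelta K b1 u * (labelDelta K b2 v * labelDelta K b3 w)
  simp only [Lwt_eq, Rcol_eq]
  linear_combination key
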